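/- Let a, b, c, d, e, f, g ∈ ℂ with e, f, g, 1−g+e, 1−g+f, 2−g all not equal to a nonpositive integer, and suppose g is not an integer. Then the two functions on D = {(x,y) ∈ ℝ² : 0 < x < 1, 0 < y} given by u₁(x,y) = F1(a,b,c,d;e,f;g;x,y) and u₂(x,y) = y^{1−g}·F1(1−g+a, b, c, 1−g+d; 1−g+e, 1−g+f; 2−g; x, y) are linearly independent over ℂ: if α·u₁ + β·u₂ vanishes identically on D for α, β ∈ ℂ, then α = β = 0. -/

import Mathlib

noncomputable def poch (a : ℂ) (n : ℕ) : ℂ := ∏ i ∈ Finset.range n, (a + i)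

/-- Kampé de Fériet function of the fourth order. -/
noncomputable def F1 (a b c d e f g x y : ℂ) : ℂ :=
  ∑' p : ℕ × ℕ,
    poch a (p.1 + p.2) * poch b p.1 * poch c p.1 * poch d p.2 /
      (poch e (p.1 + p.2) * poch f (p.1 + p.2) * poch g p.2 *
        (Nat.factorial p.1 : ℂ) * (Nat.factorial p.2 : ℂ)) * x ^ p.1 * y ^ p.2

open Filter Topology

/-- The coefficient of `x ^ p.1 * y ^ p.2` in the series of `F1`. -/
noncomputable def coeffF1 (a b c d e f g : ℂ) (p : ℕ × ℕ) : ℂ :=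
  poch a (p.1 + p.2) * poch b p.1 * poch c p.1 * poch d p.2 /
    (poch e (p.1 + p.2) * poch f (p.1 + p.2) * poch g p.2 *
      (Nat.factorial p.1 : ℂ) * (Nat.factorial p.2 : ℂ))

lemma poch_succ (a : ℂ) (n : ℕ) : poch a (n + 1) = poch a n * (a + n) :=
  Finset.prod_range_succ _ _

lemma norm_poch_le (a : ℂ) (n : ℕ) : ‖poch a n‖ ≤ (‖a‖ + 1) ^ n * n.factorial := by
  induction n with
  | zero => simp [poch]
  | succ n ih =>
    have h : ‖a + n‖ ≤ (‖a‖ + 1) * (n + 1) := by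
      have h' := norm_add_le a (n : ℂ)
      rw [Complex.norm_natCast] at h'
      nlinarith [mul_nonneg (norm_nonneg a) n.cast_nonneg]
    rw [poch_succ, norm_mul]
    calc ‖poch a n‖ * ‖a + n‖
        ≤ (‖a‖ + 1) ^ n * n.factorial * ((‖a‖ + 1) * (n + 1)) := by gcongr
      _ = (‖a‖ + 1) ^ (n + 1) * (n + 1).factorial := by
          rw [Nat.factorial_succ]; push_cast; ring

lemma exists_natCast_add_one_le_mul_norm (e : ℂ) (he : ∀ n : ℕ, e ≠ -(n : ℂ)) :
    ∃ K : ℝ, ∀ n : ℕ, (n : ℝ) + 1 ≤ K * ‖e + n‖ := by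
  have hlim : Tendsto (fun n : ℕ ↦ ‖((n : ℂ) + 1) / (e + n)‖) atTop (𝓝 ‖(1 : ℂ)‖) := by
    refine Tendsto.norm ?_
    have h := tendsto_add_mul_div_add_mul_atTop_nhds (𝕜 := ℂ) 1 e 1 one_ne_zero
    simpa [add_comm] using h
  obtain ⟨K, hK⟩ := hlim.bddAbove_range
  refine ⟨K, fun n ↦ ?_⟩
  have hpos : 0 < ‖e + n‖ := norm_pos_iff.2 fun h ↦ he n (eq_neg_of_add_eq_zero_left h)
  have h := hK (Set.mem_range_self n)
  simp only [norm_div] at h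
  rw [div_le_iff₀ hpos] at h
  rwa [← Nat.cast_add_one, Complex.norm_natCast, Nat.cast_add_one] at h

lemma exists_factorial_le_pow_mul_norm_poch (e : ℂ) (he : ∀ n : ℕ, e ≠ -(n : ℂ)) :
    ∃ K : ℝ, 0 < K ∧ ∀ n : ℕ, (n.factorial : ℝ) ≤ K ^ n * ‖poch e n‖ := by
  obtain ⟨K, hK⟩ := exists_natCast_add_one_le_mul_norm e he
  have hK0 : 0 < K := by
    by_contra! hneg
    have h := hK 0
    have h' := mul_nonpos_of_nonpos_of_nonneg hneg (norm_nonneg (e + (0 : ℕ)))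
    norm_num at h h'
    linarith
  refine ⟨K, hK0, fun n ↦ ?_⟩
  induction n with
  | zero => simp [poch]
  | succ n ih =>
    rw [poch_succ, norm_mul, Nat.factorial_succ]
    push_cast
    calc ((n : ℝ) + 1) * n.factorial
        ≤ (K * ‖e + n‖) * (K ^ n * ‖poch e n‖) := by
          gcongr
          exact hK n
      _ = K ^ (n + 1) * (‖poch e n‖ * ‖e + n‖) := by ring

lemma exists_norm_coeffF1_le (a b c d e f g : ℂ)
    (he : ∀ n : ℕ, e ≠ -(n : ℂ)) (hf : ∀ n : ℕ, f ≠ -(n : ℂ)) (hg : ∀ n : ℕ, g ≠ -(n : ℂ)) :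
    ∃ C : ℝ, 0 < C ∧ ∀ p : ℕ × ℕ, ‖coeffF1 a b c d e f g p‖ ≤ C ^ p.1 * C ^ p.2 := by
  obtain ⟨E, hE0, hE⟩ := exists_factorial_le_pow_mul_norm_poch e he
  obtain ⟨F, hF0, hF⟩ := exists_factorial_le_pow_mul_norm_poch f hf
  obtain ⟨G, hG0, hG⟩ := exists_factorial_le_pow_mul_norm_poch g hg
  set A := ‖a‖ + 1
  set B := ‖b‖ + 1
  set C := ‖c‖ + 1
  set D := ‖d‖ + 1
  have hA : 0 < A := by positivity
  have hB : 0 < B := by positivity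
  have hC : 0 < C := by positivity
  have hD : 0 < D := by positivity
  set M := A * E * F * (B * C) + A * E * F * (D * G)
  have hM₁ : A * E * F * (B * C) ≤ M := le_add_of_nonneg_right (by positivity)
  have hM₂ : A * E * F * (D * G) ≤ M := le_add_of_nonneg_left (by positivity)
  refine ⟨M, by positivity, fun ⟨m, n⟩ ↦ ?_⟩
  simp only [coeffF1, norm_div, norm_mul, Complex.norm_natCast]
  have pos : ∀ {K x : ℝ} {k : ℕ}, 0 < K → (k.factorial : ℝ) ≤ K ^ k * x → 0 < x := by
    intro K x k hK hle
    have : (0 : ℝ) < k.factorial := by exact_mod_cast k.factorial_pos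
    exact pos_of_mul_pos_right (this.trans_le hle) (by positivity)
  have he0 := pos hE0 (hE (m + n))
  have hf0 := pos hF0 (hF (m + n))
  have hg0 := pos hG0 (hG n)
  have hm0 : (0 : ℝ) < m.factorial := by exact_mod_cast m.factorial_pos
  have hn0 : (1 : ℝ) ≤ n.factorial := by exact_mod_cast n.factorial_pos
  have hmn : (m.factorial : ℝ) ≤ (m + n).factorial := by
    exact_mod_cast Nat.factorial_le (Nat.le_add_right m n)
  rw [div_le_iff₀ (by positivity)]
  calc ‖poch a (m + n)‖ * ‖poch b m‖ * ‖poch c m‖ * ‖poch d n‖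
      ≤ (A ^ (m + n) * (m + n).factorial) * (B ^ m * m.factorial) * (C ^ m * m.factorial) *
          (D ^ n * n.factorial) := by
        gcongr <;> exact norm_poch_le _ _
    _ = A ^ (m + n) * B ^ m * C ^ m * D ^ n *
          ((m + n).factorial * m.factorial * n.factorial) * m.factorial := by ring
    _ ≤ A ^ (m + n) * B ^ m * C ^ m * D ^ n *
          ((E ^ (m + n) * ‖poch e (m + n)‖) * (F ^ (m + n) * ‖poch f (m + n)‖) *
            (G ^ n * ‖poch g n‖)) * (m.factorial * n.factorial) := by
        gcongr
        · exact hE _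
        · exact hmn.trans (hF _)
        · exact hG _
        · exact le_mul_of_one_le_right hm0.le hn0
    _ = (A * E * F * (B * C)) ^ m * (A * E * F * (D * G)) ^ n *
          (‖poch e (m + n)‖ * ‖poch f (m + n)‖ * ‖poch g n‖ * m.factorial * n.factorial) := by
        simp only [mul_pow, pow_add]
        ring
    _ ≤ M ^ m * M ^ n *
          (‖poch e (m + n)‖ * ‖poch f (m + n)‖ * ‖poch g n‖ * m.factorial * n.factorial) := by
        gcongr

lemma F1_zero_zero (a b c d e f g : ℂ) : F1 a b c d e f g 0 0 = 1 := by
  rw [F1, tsum_eq_single (0, 0)]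
  · simp [poch]
  · rintro ⟨m, n⟩ h
    rcases Nat.eq_zero_or_pos m with rfl | hm
    · have hn : n ≠ 0 := fun hn ↦ h (by rw [hn])
      simp [hn]
    · simp [hm.ne']

/-- `F1` tends to `1` along the diagonal at the origin. -/
lemma tendsto_F1_diagonal (a b c d e f g : ℂ)
    (he : ∀ n : ℕ, e ≠ -(n : ℂ)) (hf : ∀ n : ℕ, f ≠ -(n : ℂ)) (hg : ∀ n : ℕ, g ≠ -(n : ℂ)) :
    Tendsto (fun t : ℝ ↦ F1 a b c d e f g t t) (𝓝 0) (𝓝 1) := by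
  obtain ⟨C, hC0, hC⟩ := exists_norm_coeffF1_le a b c d e f g he hf hg
  rw [← F1_zero_zero a b c d e f g]
  have hsum : Summable fun p : ℕ × ℕ ↦ (1 / 2 : ℝ) ^ p.1 * (1 / 2 : ℝ) ^ p.2 :=
    summable_geometric_two.mul_of_nonneg summable_geometric_two
      (fun _ ↦ by positivity) (fun _ ↦ by positivity)
  refine tendsto_tsum_of_dominated_convergence hsum (fun p ↦ ?_) ?_
  · have hcont : Continuous fun t : ℝ ↦
        coeffF1 a b c d e f g p * (t : ℂ) ^ p.1 * (t : ℂ) ^ p.2 := by fun_prop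
    simpa only [coeffF1, Complex.ofReal_zero] using hcont.tendsto 0
  · have hsmall : ∀ᶠ t : ℝ in 𝓝 0, C * |t| < 1 / 2 := by
      have hcont : Continuous fun t : ℝ ↦ C * |t| := by fun_prop
      exact hcont.continuousAt.eventually_lt_const (by norm_num)
    filter_upwards [hsmall] with t ht p
    change ‖coeffF1 a b c d e f g p * (t : ℂ) ^ p.1 * (t : ℂ) ^ p.2‖ ≤ _
    rw [norm_mul, norm_mul, norm_pow, norm_pow, Complex.norm_real, Real.norm_eq_abs]
    calc ‖coeffF1 a b c d e f g p‖ * |t| ^ p.1 * |t| ^ p.2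
        ≤ C ^ p.1 * C ^ p.2 * |t| ^ p.1 * |t| ^ p.2 := by
          gcongr
          exact hC p
      _ = (C * |t|) ^ p.1 * (C * |t|) ^ p.2 := by ring
      _ ≤ (1 / 2) ^ p.1 * (1 / 2) ^ p.2 := by gcongr

/-- A power function with nonzero exponent has no nonzero limit at `0`. -/
lemma eq_zero_of_tendsto_exp_mul_log {s L : ℂ} (hs : s ≠ 0)
    (h : Tendsto (fun t : ℝ ↦ Complex.exp (s * (Real.log t : ℂ))) (𝓝[>] 0) (𝓝 L)) : L = 0 := by
  by_contra hL
  have hone : ∀ r : ℝ, Complex.exp (s * (r : ℂ)) = 1 := by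
    intro r
    have hscale : Tendsto (fun t : ℝ ↦ Real.exp r * t) (𝓝[>] 0) (𝓝[>] 0) := by
      refine tendsto_nhdsWithin_iff.2 ⟨?_, ?_⟩
      · have hcont : Continuous fun t : ℝ ↦ Real.exp r * t := by fun_prop
        simpa using (hcont.tendsto 0).mono_left nhdsWithin_le_nhds
      · filter_upwards [self_mem_nhdsWithin] with t ht
        exact mul_pos (Real.exp_pos r) ht
    have hmul := h.const_mul (Complex.exp (s * (r : ℂ)))
    have heq : Complex.exp (s * (r : ℂ)) * L = L := by
      refine tendsto_nhds_unique (hmul.congr' ?_) (h.comp hscale)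
      filter_upwards [self_mem_nhdsWithin] with t ht
      have ht' : t ≠ 0 := ne_of_gt ht
      rw [Function.comp_apply, Real.log_mul (Real.exp_pos r).ne' ht', Real.log_exp,
        ← Complex.exp_add]
      push_cast
      ring_nf
    exact mul_right_cancel₀ hL (heq.trans (one_mul L).symm)
  have hderiv : HasDerivAt (fun r : ℝ ↦ Complex.exp (s * (r : ℂ))) s 0 := by
    simpa using ((Complex.ofRealCLM.hasDerivAt (x := (0 : ℝ))).const_mul s).cexp
  rw [funext hone] at hderiv
  exact hs (hderiv.unique (hasDerivAt_const 0 1))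

theorem stmt10 (a b c d e f g : ℂ)
    (he : ∀ n : ℕ, e ≠ -(n : ℂ)) (hf : ∀ n : ℕ, f ≠ -(n : ℂ)) (hg : ∀ n : ℕ, g ≠ -(n : ℂ))
    (he' : ∀ n : ℕ, (1 - g + e) ≠ -(n : ℂ)) (hf' : ∀ n : ℕ, (1 - g + f) ≠ -(n : ℂ)) (hg' : ∀ n : ℕ, (2 - g) ≠ -(n : ℂ))
    (hgint : ∀ n : ℤ, g ≠ (n : ℂ))
    (α β : ℂ)
    (h : ∀ x y : ℝ, 0 < x → x < 1 → 0 < y →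
      α * F1 a b c d e f g (x : ℂ) (y : ℂ)
        + β * (Complex.exp ((1 - g) * (Real.log y : ℂ)) *
            F1 (1 - g + a) b c (1 - g + d) (1 - g + e) (1 - g + f) (2 - g) (x : ℂ) (y : ℂ))
        = 0) :
    α = 0 ∧ β = 0 := by
  have hφ := (tendsto_F1_diagonal a b c d e f g he hf hg).mono_left
    (nhdsWithin_le_nhds (s := Set.Ioi 0))
  have hψ := (tendsto_F1_diagonal (1 - g + a) b c (1 - g + d) (1 - g + e) (1 - g + f) (2 - g)
    he' hf' hg').mono_left (nhdsWithin_le_nhds (s := Set.Ioi 0))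
  have hdiag : ∀ᶠ t : ℝ in 𝓝[>] 0, 0 < t ∧ t < 1 := Ioo_mem_nhdsGT one_pos
  have hs : 1 - g ≠ 0 := fun hs ↦ hgint 1 (by rw [Int.cast_one]; exact (sub_eq_zero.1 hs).symm)
  have hβ : β = 0 := by
    by_contra hβ
    have hlim : Tendsto (fun t : ℝ ↦ Complex.exp ((1 - g) * (Real.log t : ℂ))) (𝓝[>] 0)
        (𝓝 (-α / β)) := by
      have hquot := (hφ.const_mul (-α / β)).div hψ one_ne_zero
      rw [mul_one, div_one] at hquot
      refine hquot.congr' ?_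
      filter_upwards [hdiag, hψ.eventually_ne one_ne_zero] with t ht hne
      have ht' := h t t ht.1 ht.2 ht.1
      rw [Pi.div_apply, div_eq_iff hne, div_mul_eq_mul_div, div_eq_iff hβ]
      linear_combination -ht'
    have hα : α = 0 := by
      simpa [hβ] using eq_zero_of_tendsto_exp_mul_log hs hlim
    obtain ⟨t, ht, hne⟩ := (hdiag.and (hψ.eventually_ne one_ne_zero)).exists
    have ht' := h t t ht.1 ht.2 ht.1
    rw [hα, zero_mul, zero_add] at ht'
    exact mul_ne_zero hβ (mul_ne_zero (Complex.exp_ne_zero _) hne) ht'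
  obtain ⟨t, ht, hne⟩ := (hdiag.and (hφ.eventually_ne one_ne_zero)).exists
  have ht' := h t t ht.1 ht.2 ht.1
  rw [hβ, zero_mul, add_zero] at ht'
  exact ⟨(mul_eq_zero.1 ht').resolve_right hne, hβ⟩
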